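/- Let y, F, G \in \mathbb{R}^n, L(v) := |y - v|^2, 0 < \kappa < 1, and suppose L(F+G) \leq \kappa L(F) with L(F) > 0. Suppose further that g \in \mathbb{R}^n with |g| = 1 satisfies 2 (y-F) \cdot g \geq \gamma \cdot 2 (y-F) \cdot (G/|G|) for some \gamma \in (0,1]. Then with \alpha := \gamma (1-\kappa) \sqrt{L(F)} / 4, one has L(F + \alpha g) \leq (1 - \gamma^2 (1-\kappa)^2 / 8) L(F). -/

import Mathlib

open scoped InnerProductSpace

/-- If adding `G` shrinks the squared residual `‖r‖ ^ 2` by a factor `κ`, then `r` correlates with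
the direction of `G`. -/
theorem mul_norm_le_inner_normalized_of_norm_sub_sq_le {E : Type*} [NormedAddCommGroup E]
    [InnerProductSpace ℝ E] {r G : E} {κ : ℝ} (hκ0 : 0 ≤ κ) (hκ1 : κ < 1)
    (hr : 0 < ‖r‖) (h : ‖r - G‖ ^ 2 ≤ κ * ‖r‖ ^ 2) :
    (1 - κ) * ‖r‖ ≤ ⟪r, (1 / ‖G‖) • G⟫_ℝ := by
  have hG : 0 < ‖G‖ := by
    rw [norm_pos_iff]
    rintro rfl
    rw [sub_zero] at h
    nlinarith [pow_pos hr 2]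
  rw [inner_smul_right, one_div_mul_eq_div, le_div_iff₀ hG]
  rw [norm_sub_sq_real] at h
  nlinarith [mul_nonneg (sub_nonneg.2 hκ1.le) (sq_nonneg (‖r‖ - ‖G‖)),
    mul_nonneg hκ0 (sq_nonneg ‖G‖)]

theorem stmt_9 (n : ℕ) (y F G g : EuclideanSpace ℝ (Fin n))
    (κ : ℝ) (hκ0 : 0 < κ) (hκ1 : κ < 1)
    (hF : 0 < ‖y - F‖ ^ 2)
    (hG : ‖y - (F + G)‖ ^ 2 ≤ κ * ‖y - F‖ ^ 2)
    (hg : ‖g‖ = 1) (γ : ℝ) (hγ0 : 0 < γ) (hγ1 : γ ≤ 1)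
    (hcorr : 2 * ⟪y - F, g⟫_ℝ ≥ γ * (2 * ⟪y - F, (1 / ‖G‖) • G⟫_ℝ)) :
    ‖y - (F + (γ * (1 - κ) * Real.sqrt (‖y - F‖ ^ 2) / 4) • g)‖ ^ 2 ≤
      (1 - γ ^ 2 * (1 - κ) ^ 2 / 8) * ‖y - F‖ ^ 2 := by
  rw [← sub_sub] at hG ⊢
  have hr : 0 < ‖y - F‖ := (norm_nonneg _).lt_of_ne (by rintro h; simp [← h] at hF)
  have hdir := mul_norm_le_inner_normalized_of_norm_sub_sq_le hκ0.le hκ1 hr hG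
  have hinner : γ * (1 - κ) * ‖y - F‖ ≤ ⟪y - F, g⟫_ℝ := by
    linarith [mul_le_mul_of_nonneg_left hdir hγ0.le]
  have hα : 0 ≤ γ * (1 - κ) * ‖y - F‖ :=
    mul_nonneg (mul_nonneg hγ0.le (sub_nonneg.2 hκ1.le)) hr.le
  rw [Real.sqrt_sq hr.le, norm_sub_sq_real, inner_smul_right, norm_smul, hg, mul_one,
    Real.norm_eq_abs, sq_abs]
  linarith [mul_le_mul_of_nonneg_left hinner hα, sq_nonneg (γ * (1 - κ) * ‖y - F‖)]
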